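/- Let f ∈ C(x), let L = D + f, and let c ∈ C be a pole of f. Then Sind(D + f + 1/(x - c)) ≤ Sind(D + f) + 1. -/

import Mathlib

open Polynomial

/-- The derivative of a rational function, computed via the quotient rule on the
reduced numerator/denominator representation. -/
noncomputable def rderiv {C : Type} [Field C] (f : RatFunc C) : RatFunc C :=
  algebraMap (Polynomial C) (RatFunc C)
      (derivative f.num * f.denom - f.num * derivative f.denom) /
    algebraMap (Polynomial C) (RatFunc C) (f.denom ^ 2)

/-- The adjoint of the first-order operator `D + f` applied to `r`: `L*(r) = -r' + f*r`. -/
noncomputable def adjD {C : Type} [Field C] (f r : RatFunc C) : RatFunc C :=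
  -rderiv r + f * r

/-- The stability index of an operator with adjoint action `adj` on `C(x)`: the minimal
`m` such that for every `i ≥ m` there is a polynomial of degree `i` in the image of the
adjoint on `C(x)`. -/
noncomputable def sindOf {C : Type} [Field C] (adj : RatFunc C → RatFunc C) : ℕ :=
  sInf {m : ℕ | ∀ i : ℕ, m ≤ i → ∃ p : Polynomial C, p.degree = (i : ℕ) ∧
    ∃ r : RatFunc C, adj r = algebraMap (Polynomial C) (RatFunc C) p}

theorem rderiv_div {C : Type} [Field C] (p q : Polynomial C) (hq : q ≠ 0) :
    rderiv (algebraMap (Polynomial C) (RatFunc C) p / algebraMap (Polynomial C) (RatFunc C) q) =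
      algebraMap (Polynomial C) (RatFunc C) (derivative p * q - p * derivative q) /
        algebraMap (Polynomial C) (RatFunc C) (q ^ 2) := by
  set f := algebraMap (Polynomial C) (RatFunc C) p / algebraMap (Polynomial C) (RatFunc C) q
    with hf
  have hd : f.denom ≠ 0 := f.denom_ne_zero
  have hnd : f.num * q = p * f.denom := by
    have h := f.num_div_denom
    rw [hf, div_eq_div_iff (RatFunc.algebraMap_ne_zero hd) (RatFunc.algebraMap_ne_zero hq),
      ← map_mul, ← map_mul] at h
    exact RatFunc.algebraMap_injective C h
  have hnd' := congrArg derivative hnd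
  simp only [derivative_mul] at hnd'
  rw [rderiv, div_eq_div_iff (RatFunc.algebraMap_ne_zero (pow_ne_zero 2 hd))
    (RatFunc.algebraMap_ne_zero (pow_ne_zero 2 hq)), ← map_mul, ← map_mul]
  congr 1
  linear_combination f.denom * q * hnd' - (derivative f.denom * q + f.denom * derivative q) * hnd

theorem rderiv_algebraMap {C : Type} [Field C] (p : Polynomial C) :
    rderiv (algebraMap (Polynomial C) (RatFunc C) p) =
      algebraMap (Polynomial C) (RatFunc C) (derivative p) := by
  simpa using rderiv_div p 1 one_ne_zero

theorem rderiv_algebraMap_mul {C : Type} [Field C] (p : Polynomial C) (r : RatFunc C) :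
    rderiv (algebraMap (Polynomial C) (RatFunc C) p * r) =
      algebraMap (Polynomial C) (RatFunc C) (derivative p) * r +
        algebraMap (Polynomial C) (RatFunc C) p * rderiv r := by
  have hd := RatFunc.algebraMap_ne_zero r.denom_ne_zero
  have h : algebraMap (Polynomial C) (RatFunc C) p * r =
      algebraMap (Polynomial C) (RatFunc C) (p * r.num) /
        algebraMap (Polynomial C) (RatFunc C) r.denom := by
    rw [map_mul, mul_div_assoc, r.num_div_denom]
  have hr : algebraMap (Polynomial C) (RatFunc C) r.num =
      r * algebraMap (Polynomial C) (RatFunc C) r.denom := by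
    rw [← div_eq_iff hd, r.num_div_denom]
  rw [h, rderiv_div _ _ r.denom_ne_zero, rderiv]
  simp only [derivative_mul, map_mul, map_sub, map_add, map_pow, hr]
  field_simp
  ring

/-- The image of the adjoint of `D + f + 1/(x-c)` contains `x - c` times that of `D + f`. -/
theorem adjD_add_simple_pole {C : Type} [Field C] (f r : RatFunc C) (c : C) :
    adjD (f + 1 / (RatFunc.X - RatFunc.C c))
        (algebraMap (Polynomial C) (RatFunc C) (X - Polynomial.C c) * r) =
      algebraMap (Polynomial C) (RatFunc C) (X - Polynomial.C c) * adjD f r := by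
  have hX : (RatFunc.X - RatFunc.C c : RatFunc C) =
      algebraMap (Polynomial C) (RatFunc C) (X - Polynomial.C c) := by simp
  have h0 := RatFunc.algebraMap_ne_zero (X_sub_C_ne_zero c)
  rw [adjD, adjD, rderiv_algebraMap_mul, hX, derivative_X_sub_C, map_one]
  field_simp
  ring

theorem exists_degree_sub_natCast_mul {C : Type} [Field C] [CharZero C] (v b : Polynomial C)
    (hb : b ≠ 0) :
    ∃ d N : ℕ, ∀ n : ℕ, N ≤ n → (v - (n : Polynomial C) * b).degree = (d : ℕ) := by
  set d := max v.natDegree b.natDegree with hd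
  have hcoeff : ∃ N : ℕ, ∀ n : ℕ, N ≤ n → v.coeff d - n * b.coeff d ≠ 0 := by
    by_cases hbd : b.coeff d = 0
    · have hlt : b.natDegree ≠ d := fun h => hb (leadingCoeff_eq_zero.mp (by
        rwa [← h, coeff_natDegree] at hbd))
      have hvd : v.natDegree = d := by omega
      have hv : v ≠ 0 := by
        rintro rfl
        simp only [natDegree_zero] at hvd hd
        omega
      refine ⟨0, fun n _ => ?_⟩
      rw [hbd, mul_zero, sub_zero, ← hvd, coeff_natDegree]
      exact leadingCoeff_ne_zero.mpr hv
    · by_cases h : ∃ n : ℕ, v.coeff d - n * b.coeff d = 0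
      · obtain ⟨m, hm⟩ := h
        refine ⟨m + 1, fun n hn h0 => ?_⟩
        have hnm : (n : C) = m :=
          mul_right_cancel₀ hbd (by linear_combination hm - h0)
        have := Nat.cast_injective hnm
        omega
      · push Not at h
        exact ⟨0, fun n _ => h n⟩
  obtain ⟨N, hN⟩ := hcoeff
  refine ⟨d, N, fun n hn => degree_eq_of_le_of_coeff_ne_zero ?_ ?_⟩
  · refine natDegree_le_iff_degree_le.mp ((natDegree_sub_le _ _).trans (max_le_max le_rfl ?_))
    simpa using natDegree_mul_le (p := (n : Polynomial C)) (q := b)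
  · rw [coeff_sub, ← map_natCast Polynomial.C, coeff_C_mul]
    exact hN n hn

theorem adjD_algebraMap_denom_mul {C : Type} [Field C] (f : RatFunc C) (q : Polynomial C) :
    adjD f (algebraMap (Polynomial C) (RatFunc C) (f.denom * q)) =
      algebraMap (Polynomial C) (RatFunc C)
        ((f.num - derivative f.denom) * q - f.denom * derivative q) := by
  have hd := RatFunc.algebraMap_ne_zero f.denom_ne_zero
  have hf : f * algebraMap (Polynomial C) (RatFunc C) f.denom =
      algebraMap (Polynomial C) (RatFunc C) f.num := by
    rw [← eq_div_iff hd, f.num_div_denom]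
  rw [adjD, rderiv_algebraMap]
  simp only [derivative_mul, map_mul, map_sub, map_add]
  linear_combination algebraMap (Polynomial C) (RatFunc C) q * hf

/-- The set whose infimum defines the stability index of `D + f` is nonempty. -/
theorem exists_forall_degree_adjD {C : Type} [Field C] [CharZero C] (f : RatFunc C) :
    ∃ m : ℕ, ∀ i : ℕ, m ≤ i → ∃ p : Polynomial C, p.degree = (i : ℕ) ∧
      ∃ r : RatFunc C, adjD f r = algebraMap (Polynomial C) (RatFunc C) p := by
  obtain ⟨d, N, h⟩ := exists_degree_sub_natCast_mul
    ((f.num - derivative f.denom) * X) f.denom f.denom_ne_zero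
  refine ⟨d + N, fun i hi => ?_⟩
  obtain ⟨n, rfl⟩ := Nat.exists_eq_add_of_le (show d ≤ i by omega)
  refine ⟨_, ?_, _, adjD_algebraMap_denom_mul f (X ^ (n + 1))⟩
  have hfactor : (f.num - derivative f.denom) * X ^ (n + 1) -
      f.denom * derivative (X ^ (n + 1)) =
      ((f.num - derivative f.denom) * X - ((n + 1 : ℕ) : Polynomial C) * f.denom) * X ^ n := by
    rw [derivative_X_pow_succ]
    simp only [map_add, map_natCast, map_one, Nat.cast_add, Nat.cast_one]
    ring
  rw [hfactor, degree_mul, h (n + 1) (by omega), degree_X_pow, Nat.cast_add]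

/-- Proposition 4.9(1). Let `c` be a pole of `f`. Then
`Sind(D + f + 1/(x-c)) ≤ Sind(D + f) + 1`. -/
theorem sind_add_simple_pole_le {C : Type} [Field C] [IsAlgClosed C] [CharZero C]
    (f : RatFunc C) (c : C) (hc : f.denom.eval c = 0) :
    sindOf (adjD (f + 1 / (RatFunc.X - RatFunc.C c))) ≤ sindOf (adjD f) + 1 := by
  refine Nat.sInf_le fun i hi => ?_
  obtain ⟨j, rfl⟩ := Nat.exists_eq_add_of_le' (show 1 ≤ i by omega)
  obtain ⟨p, hp, r, hr⟩ := Nat.sInf_mem (exists_forall_degree_adjD f) j (Nat.le_of_succ_le_succ hi)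
  refine ⟨(X - Polynomial.C c) * p, ?_, _, (adjD_add_simple_pole f r c).trans (by rw [hr, map_mul])⟩
  rw [degree_mul, degree_X_sub_C, hp, add_comm, Nat.cast_add, Nat.cast_one]
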